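/- Let H > 0, C > 0, 0 ≤ p ≤ 4, and let h : [0,∞)×[0,∞) → ℝ be C¹ in r with |∂h/∂r (u,ρ)| ≤ C e^{−Hu} (1+ρ)^{−p} for all u, ρ ≥ 0. Then there is a constant C' (depending only on C and p) such that for all (u,r): if 2 < p ≤ 4 then |h(u,r) − h̄(u,r)| ≤ C' e^{−Hu}/(1+r), and if 0 ≤ p ≤ 2 then |h(u,r) − h̄(u,r)| ≤ C' r e^{−Hu}. -/

import Mathlib

open Real Set

/-- The spherical mean `h̄(u,r) = (1/r) ∫₀^r h(u,s) ds`, with `h̄(u,0) = h(u,0)`. -/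
noncomputable def hbar (h : ℝ → ℝ → ℝ) (u r : ℝ) : ℝ :=
  if r = 0 then h u 0 else (∫ s in (0:ℝ)..r, h u s) / r

/-- The quantity `x f(x) - ∫₀ˣ f` has one-sided derivative `x f'(x)` on `[0,∞)`. -/
theorem hasDerivWithinAt_mul_sub_integral {f : ℝ → ℝ} (hf : DifferentiableOn ℝ f (Ici 0))
    {x : ℝ} (hx : 0 ≤ x) :
    HasDerivWithinAt (fun y => y * f y - ∫ s in (0:ℝ)..y, f s)
      (x * derivWithin f (Ici 0) x) (Ici 0) x := by
  have hg : Continuous fun y => f (max y 0) :=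
    hf.continuousOn.comp_continuous (by fun_prop) fun y => le_max_right y 0
  have hint : HasDerivWithinAt (fun y => ∫ s in (0:ℝ)..y, f s) (f x) (Ici 0) x := by
    have h := (hg.integral_hasStrictDerivAt 0 x).hasDerivAt.hasDerivWithinAt (s := Ici 0)
    rw [max_eq_left hx] at h
    have heq : ∀ y ∈ Ici (0:ℝ), ∫ s in (0:ℝ)..y, f s = ∫ s in (0:ℝ)..y, f (max s 0) := by
      intro y hy
      refine intervalIntegral.integral_congr fun s hs => ?_
      rw [uIcc_of_le hy] at hs
      simp only [max_eq_left hs.1]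
    exact h.congr heq (heq x hx)
  have hd := (hf x hx).hasDerivWithinAt
  exact (((hasDerivWithinAt_id x _).mul hd).sub hint).congr_deriv (by simp)

/-- A derivative bound on `f` bounds `x f(x) - ∫₀ˣ f` by any primitive of a majorant of `x |f'|`. -/
theorem abs_mul_sub_integral_le {f B B' : ℝ → ℝ} (hf : DifferentiableOn ℝ f (Ici 0))
    (hB0 : 0 ≤ B 0) (hB : ∀ x, 0 ≤ x → HasDerivAt B (B' x) x)
    (bound : ∀ x, 0 ≤ x → x * |derivWithin f (Ici 0) x| ≤ B' x) {r : ℝ} (hr : 0 ≤ r) :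
    |r * f r - ∫ s in (0:ℝ)..r, f s| ≤ B r := by
  have key := image_norm_le_of_norm_deriv_right_le_deriv_boundary' (a := 0) (b := r)
    (f := fun y => y * f y - ∫ s in (0:ℝ)..y, f s)
    (f' := fun x => x * derivWithin f (Ici 0) x) (B := B) (B' := B')
    (fun x hx => ((hasDerivWithinAt_mul_sub_integral hf hx.1).continuousWithinAt).mono
      Icc_subset_Ici_self)
    (fun x hx => (hasDerivWithinAt_mul_sub_integral hf hx.1).mono (Ici_subset_Ici.2 hx.1))
    (by simpa using hB0)
    (fun x hx => (hB x hx.1).continuousAt.continuousWithinAt)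
    (fun x hx => (hB x hx.1).hasDerivWithinAt)
    (fun x hx => by
      rw [Real.norm_eq_abs, abs_mul, abs_of_nonneg hx.1]
      exact bound x hx.1)
  exact key (right_mem_Icc.2 hr)

/-- Bound on `x f(x) - ∫₀ˣ f` that is quadratic in `x`, for bounded `f'`. -/
theorem abs_mul_sub_integral_le_mul_sq {f : ℝ → ℝ} {A p : ℝ} (hA : 0 ≤ A) (hp : 0 ≤ p)
    (hf : DifferentiableOn ℝ f (Ici 0))
    (hf' : ∀ x, 0 ≤ x → |derivWithin f (Ici 0) x| ≤ A * (1 + x) ^ (-p)) {r : ℝ} (hr : 0 ≤ r) :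
    |r * f r - ∫ s in (0:ℝ)..r, f s| ≤ A * r ^ 2 := by
  refine abs_mul_sub_integral_le (B := fun x => A * x ^ 2) (B' := fun x => A * (2 * x)) hf
    (by simp) (fun x _ => ?_) (fun x hx => ?_) hr
  · simpa using (hasDerivAt_pow 2 x).const_mul A
  · have h1 : (1 + x) ^ (-p) ≤ 1 :=
      Real.rpow_le_one_of_one_le_of_nonpos (by linarith) (by linarith)
    have h2 : |derivWithin f (Ici 0) x| ≤ A := (hf' x hx).trans (mul_le_of_le_one_right hA h1)
    nlinarith [mul_le_mul_of_nonneg_left h2 hx, mul_nonneg hx hA]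

/-- Uniform bound on `x f(x) - ∫₀ˣ f`, when `f'` decays faster than quadratically. -/
theorem abs_mul_sub_integral_le_div {f : ℝ → ℝ} {A p : ℝ} (hA : 0 ≤ A) (hp : 2 < p)
    (hf : DifferentiableOn ℝ f (Ici 0))
    (hf' : ∀ x, 0 ≤ x → |derivWithin f (Ici 0) x| ≤ A * (1 + x) ^ (-p)) {r : ℝ} (hr : 0 ≤ r) :
    |r * f r - ∫ s in (0:ℝ)..r, f s| ≤ A / (p - 2) := by
  have hp2 : 0 < p - 2 := sub_pos.2 hp
  have hmain := abs_mul_sub_integral_le (B := fun x => A / (p - 2) * (1 - (1 + x) ^ (2 - p)))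
    (B' := fun x => A * (1 + x) ^ (1 - p)) hf (by simp) (fun x hx => ?_) (fun x hx => ?_) hr
  · refine hmain.trans (mul_le_of_le_one_right (by positivity) ?_)
    have : 0 ≤ (1 + r) ^ (2 - p) := by positivity
    linarith
  · have h1 : HasDerivAt (fun y : ℝ => 1 + y) 1 x := (hasDerivAt_id x).const_add 1
    have h2 := ((h1.rpow_const (p := 2 - p) (Or.inl (by positivity))).const_sub 1).const_mul
      (A / (p - 2))
    refine h2.congr_deriv ?_
    rw [show 2 - p - 1 = 1 - p by ring]
    field_simp
    ring
  · have hpos : 0 < 1 + x := by linarith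
    have h1 : (1 + x) ^ (1 - p) = (1 + x) * (1 + x) ^ (-p) := by
      rw [sub_eq_add_neg, Real.rpow_add hpos, Real.rpow_one]
    have h2 : 0 ≤ A * (1 + x) ^ (-p) := by positivity
    rw [h1]
    nlinarith [mul_le_mul_of_nonneg_left (hf' x hx) hx]

/-- If `h` is `C¹` in `r` with
`|∂_r h(u,ρ)| ≤ C e^{-Hu} (1+ρ)^{-p}` for some `0 ≤ p ≤ 4`, then there is `C'`
(depending only on `C` and `p`) such that `|h - h̄| ≤ C' e^{-Hu}/(1+r)` if `2 < p ≤ 4`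
and `|h - h̄| ≤ C' r e^{-Hu}` if `0 ≤ p ≤ 2`. -/
theorem mean_difference_decay
    (C p : ℝ) (hC : 0 < C) (hp0 : 0 ≤ p) (hp4 : p ≤ 4) :
    ∃ C' : ℝ, 0 < C' ∧
      ∀ (H : ℝ), 0 < H →
      ∀ h : ℝ → ℝ → ℝ,
        (∀ u, 0 ≤ u → DifferentiableOn ℝ (fun ρ => h u ρ) (Set.Ici 0)) →
        (∀ u ρ : ℝ, 0 ≤ u → 0 ≤ ρ →
          |derivWithin (fun ρ' => h u ρ') (Set.Ici 0) ρ|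
            ≤ C * Real.exp (-H * u) * (1 + ρ) ^ (-p)) →
        ∀ u r : ℝ, 0 ≤ u → 0 ≤ r →
          (2 < p → |h u r - hbar h u r| ≤ C' * Real.exp (-H * u) / (1 + r)) ∧
          (p ≤ 2 → |h u r - hbar h u r| ≤ C' * r * Real.exp (-H * u)) := by
  have hD : 0 < 2 + 2 / |p - 2| := by positivity
  refine ⟨C * (2 + 2 / |p - 2|), by positivity, fun H _ h hd hb u r hu hr => ?_⟩
  have hE := Real.exp_pos (-H * u)
  set E := Real.exp (-H * u)
  have hA : 0 < C * E := by positivity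
  rcases hr.eq_or_lt with rfl | hr
  · have h0 : h u 0 - hbar h u 0 = 0 := by simp [hbar]
    rw [h0, abs_zero]
    exact ⟨fun _ => by positivity, fun _ => by simp⟩
  have hsq := abs_mul_sub_integral_le_mul_sq hA.le hp0 (hd u hu) (fun x => hb u x hu) hr.le
  have hmean : r * |h u r - hbar h u r| = |r * h u r - ∫ s in (0:ℝ)..r, h u s| := by
    rw [hbar, if_neg hr.ne', ← abs_of_pos hr, ← abs_mul, abs_of_pos hr, mul_sub,
      mul_div_cancel₀ _ hr.ne']
  rw [← hmean] at hsq
  have hlin : |h u r - hbar h u r| ≤ C * E * r := by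
    refine le_of_mul_le_mul_left ?_ hr
    linarith
  have hq : 0 ≤ 2 / |p - 2| := by positivity
  refine ⟨fun hp => ?_, fun _ => ?_⟩
  · have hdiv := abs_mul_sub_integral_le_div hA.le hp (hd u hu) (fun x => hb u x hu) hr.le
    rw [← hmean] at hdiv
    have hp2 : |p - 2| = p - 2 := abs_of_pos (sub_pos.2 hp)
    rw [le_div_iff₀ (by linarith), hp2,
      show C * (2 + 2 / (p - 2)) * E = 2 * (C * E) + 2 * (C * E / (p - 2)) by ring]
    have hQ : 0 ≤ C * E / (p - 2) := div_nonneg hA.le (sub_pos.2 hp).le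
    rcases le_total r 1 with h1 | h1
    · nlinarith
    · nlinarith [mul_le_mul_of_nonneg_right h1 (abs_nonneg (h u r - hbar h u r))]
  · have : 0 ≤ C * E * r := by positivity
    nlinarith [mul_nonneg this hq]
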